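/- arXiv:math/0608423 — 3 statements merged into one kernel-verified Lean document; each statement's English description precedes it below -/
import Mathlib

section
/- Let p ≥ 1 be a natural number and let b be the (p+1)×(p+1) real matrix with entries b_{α,β} = √(β(p−β+1)) if α = β+1 and b_{α,β} = 0 otherwise (rows and columns indexed by 1,…,p+1). Then (1/2)·(bᵀ·b − b·bᵀ) is the diagonal matrix whose β-th diagonal entry equals p/2 − β + 1; in particular the diagonal entries run through p/2, p/2 − 1, …, −p/2. -/
namespace Matrix

variable {R : Type*} [NonUnitalNonAssocSemiring R] {n : ℕ} {b : Matrix (Fin n) (Fin n) R} {w : ℕ → R}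

/-- The Gram matrix of the columns of a weighted shift matrix is diagonal. -/
theorem transpose_mul_self_of_subdiagonal
    (hb : ∀ i j : Fin n, b i j = if (i : ℕ) = j + 1 then w j else 0) :
    bᵀ * b = diagonal fun i : Fin n => if (i : ℕ) + 1 < n then w i * w i else 0 := by
  ext i j
  rw [mul_apply, diagonal_apply]
  by_cases hi : (i : ℕ) + 1 < n
  · rw [Finset.sum_eq_single ⟨i + 1, hi⟩]
    · rcases eq_or_ne i j with rfl | hij
      · simp [hb, hi]
      · simp [hb, hij, Fin.val_ne_of_ne hij]
    · intro k _ hk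
      have : (k : ℕ) ≠ i + 1 := fun h => hk (Fin.ext h)
      simp [hb, this]
    · simp
  · rw [if_neg hi, ite_self]
    refine Finset.sum_eq_zero fun k _ => ?_
    have : (k : ℕ) ≠ i + 1 := by omega
    simp [hb, this]

/-- The Gram matrix of the rows of a weighted shift matrix is diagonal. -/
theorem mul_transpose_self_of_subdiagonal
    (hb : ∀ i j : Fin n, b i j = if (i : ℕ) = j + 1 then w j else 0) :
    b * bᵀ = diagonal fun i : Fin n => if 0 < (i : ℕ) then w (i - 1) * w (i - 1) else 0 := by
  ext i j
  rw [mul_apply, diagonal_apply]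
  by_cases hi : 0 < (i : ℕ)
  · have hi' : (i : ℕ) - 1 + 1 = i := Nat.sub_add_cancel hi
    rw [Finset.sum_eq_single ⟨i - 1, by omega⟩]
    · rcases eq_or_ne i j with rfl | hij
      · simp [hb, hi, hi']
      · simp [hb, hij, hi', (Fin.val_ne_of_ne hij).symm]
    · intro k _ hk
      have : (i : ℕ) ≠ k + 1 := fun h => hk (Fin.ext (by simp [h]))
      simp [hb, this]
    · simp
  · rw [if_neg hi, ite_self]
    refine Finset.sum_eq_zero fun k _ => ?_
    have : (i : ℕ) ≠ k + 1 := by omega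
    simp [hb, this]

end Matrix


/-- For Green's parafermi matrix `b` of order `p ≥ 1`,
`(1/2)·(bᵀ·b − b·bᵀ)` is the diagonal matrix with β-th diagonal entry `p/2 − β + 1`
(rows and columns indexed by 1,…,p+1, so index `β : Fin (p+1)` corresponds to `β+1`). -/
theorem green_spin_representation (p : ℕ) (hp : 1 ≤ p)
    (b : Matrix (Fin (p + 1)) (Fin (p + 1)) ℝ)
    (hb : ∀ α β : Fin (p + 1), b α β =
      if (α : ℕ) = (β : ℕ) + 1 then
        Real.sqrt ((((β : ℕ) : ℝ) + 1) * ((p : ℝ) - (((β : ℕ) : ℝ) + 1) + 1))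
      else 0) :
    (1 / 2 : ℝ) • (b.transpose * b - b * b.transpose) =
      Matrix.diagonal (fun β : Fin (p + 1) => (p : ℝ) / 2 - ((((β : ℕ) : ℝ)) + 1) + 1) := by
  set w : ℕ → ℝ := fun k => √(((k : ℝ) + 1) * ((p : ℝ) - ((k : ℝ) + 1) + 1)) with hw
  have hw_sq (k : ℕ) (hk : k ≤ p) : w k * w k = (k + 1) * (p - k) := by
    have hk' : (k : ℝ) ≤ p := by exact_mod_cast hk
    rw [hw, Real.mul_self_sqrt (mul_nonneg (by positivity) (by linarith))]
    ring
  rw [Matrix.transpose_mul_self_of_subdiagonal (w := w) hb,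
    Matrix.mul_transpose_self_of_subdiagonal (w := w) hb, Matrix.diagonal_sub,
    ← Matrix.diagonal_smul]
  congr 1
  ext i
  have hi : (i : ℕ) ≤ p := Nat.lt_succ_iff.mp i.isLt
  have lower : (if (i : ℕ) + 1 < p + 1 then w i * w i else 0) = ((i : ℝ) + 1) * (p - i) := by
    split_ifs with h
    · exact hw_sq i hi
    · have : (i : ℕ) = p := by omega
      simp [this]
  have upper : (if 0 < (i : ℕ) then w (i - 1) * w (i - 1) else 0) = (i : ℝ) * (p - i + 1) := by
    split_ifs with h
    · rw [hw_sq _ (by omega), Nat.cast_pred h]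
      ring
    · have : (i : ℕ) = 0 := by omega
      simp [this]
  simp only [Pi.smul_apply, lower, upper, smul_eq_mul]
  ring
end

section
/- Let p ≥ 1 be a natural number and let b be Green's parafermi matrix of order p. Setting N = bᵀ·b − b·bᵀ, the trilinear parafermi relations hold: N·b − b·N = −2·b and N·bᵀ − bᵀ·N = 2·bᵀ. -/
lemma parafermi_weight_nonneg {p j : ℕ} (hj : j ≤ p) :
    0 ≤ ((j : ℝ) + 1) * ((p : ℝ) - ((j : ℝ) + 1) + 1) := by
  have : (j : ℝ) ≤ p := by exact_mod_cast hj
  apply mul_nonneg <;> linarith [(j.cast_nonneg : (0 : ℝ) ≤ j)]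

/-- The Gram matrix `bᵀ b` of Green's matrix is diagonal. -/
lemma parafermi_transpose_mul_self {p : ℕ} {b : Matrix (Fin (p + 1)) (Fin (p + 1)) ℝ}
    (hb : ∀ α β : Fin (p + 1), b α β =
      if (α : ℕ) = (β : ℕ) + 1 then
        Real.sqrt ((((β : ℕ) : ℝ) + 1) * ((p : ℝ) - (((β : ℕ) : ℝ) + 1) + 1))
      else 0) :
    b.transpose * b =
      Matrix.diagonal fun i : Fin (p + 1) => (((i : ℕ) : ℝ) + 1) * ((p : ℝ) - ((i : ℕ) : ℝ)) := by
  ext i j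
  rw [Matrix.mul_apply]
  simp only [Matrix.transpose_apply]
  rcases eq_or_ne i j with rfl | hij
  · rw [Matrix.diagonal_apply_eq]
    rcases Nat.lt_or_ge i p with hi | hi
    · rw [Finset.sum_eq_single (⟨i + 1, by omega⟩ : Fin (p + 1))]
      · rw [hb, if_pos rfl, Real.mul_self_sqrt (parafermi_weight_nonneg hi.le)]
        ring
      · intro k _ hk
        rw [hb, if_neg (fun h => hk (Fin.ext h)), mul_zero]
      · simp
    · have hip : (i : ℕ) = p := by omega
      rw [hip, sub_self, mul_zero]
      refine Finset.sum_eq_zero fun k _ => ?_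
      rw [hb, if_neg (by omega), mul_zero]
  · rw [Matrix.diagonal_apply_ne _ hij]
    refine Finset.sum_eq_zero fun k _ => ?_
    rw [hb, hb]
    split_ifs with h₁ h₂
    · exact absurd (Fin.ext (by omega)) hij
    all_goals simp

/-- The matrix `b bᵀ` of Green's matrix is diagonal. -/
lemma parafermi_mul_transpose_self {p : ℕ} {b : Matrix (Fin (p + 1)) (Fin (p + 1)) ℝ}
    (hb : ∀ α β : Fin (p + 1), b α β =
      if (α : ℕ) = (β : ℕ) + 1 then
        Real.sqrt ((((β : ℕ) : ℝ) + 1) * ((p : ℝ) - (((β : ℕ) : ℝ) + 1) + 1))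
      else 0) :
    b * b.transpose =
      Matrix.diagonal fun i : Fin (p + 1) => ((i : ℕ) : ℝ) * ((p : ℝ) - ((i : ℕ) : ℝ) + 1) := by
  ext i j
  rw [Matrix.mul_apply]
  simp only [Matrix.transpose_apply]
  rcases eq_or_ne i j with rfl | hij
  · rw [Matrix.diagonal_apply_eq]
    rcases Nat.eq_zero_or_pos i with hi | hi
    · rw [hi, Nat.cast_zero, zero_mul]
      refine Finset.sum_eq_zero fun k _ => ?_
      rw [hb, if_neg (by omega), mul_zero]
    · have hpred : (i : ℕ) = (i : ℕ) - 1 + 1 := by omega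
      rw [Finset.sum_eq_single (⟨i - 1, by omega⟩ : Fin (p + 1))]
      · rw [hb, if_pos hpred, Real.mul_self_sqrt (parafermi_weight_nonneg (by dsimp only; omega))]
        have hcast : (((i : ℕ) - 1 : ℕ) : ℝ) + 1 = ((i : ℕ) : ℝ) := by exact_mod_cast hpred.symm
        rw [hcast]
      · intro k _ hk
        rw [hb, if_neg (fun h => hk (Fin.ext (by dsimp only; omega))), mul_zero]
      · simp
  · rw [Matrix.diagonal_apply_ne _ hij]
    refine Finset.sum_eq_zero fun k _ => ?_
    rw [hb, hb]
    split_ifs with h₁ h₂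
    · exact absurd (Fin.ext (by omega)) hij
    all_goals simp

/-- For Green's parafermi matrix `b` of order `p ≥ 1` and
`N = bᵀ·b − b·bᵀ`, the trilinear parafermi relations hold:
`N·b − b·N = −2·b` and `N·bᵀ − bᵀ·N = 2·bᵀ`. -/
theorem green_trilinear_relations (p : ℕ) (hp : 1 ≤ p)
    (b N : Matrix (Fin (p + 1)) (Fin (p + 1)) ℝ)
    (hb : ∀ α β : Fin (p + 1), b α β =
      if (α : ℕ) = (β : ℕ) + 1 then
        Real.sqrt ((((β : ℕ) : ℝ) + 1) * ((p : ℝ) - (((β : ℕ) : ℝ) + 1) + 1))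
      else 0)
    (hN : N = b.transpose * b - b * b.transpose) :
    N * b - b * N = (-2 : ℝ) • b ∧
    N * b.transpose - b.transpose * N = (2 : ℝ) • b.transpose := by
  have hdiag : N = Matrix.diagonal fun i : Fin (p + 1) => (p : ℝ) - 2 * ((i : ℕ) : ℝ) := by
    rw [hN, parafermi_transpose_mul_self hb, parafermi_mul_transpose_self hb,
      Matrix.diagonal_sub]
    congr 1
    ext i
    ring
  have hcomm : N * b - b * N = (-2 : ℝ) • b := by
    ext i j
    rw [hdiag, Matrix.sub_apply, Matrix.diagonal_mul, Matrix.mul_diagonal, Matrix.smul_apply,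
      smul_eq_mul]
    by_cases h : (i : ℕ) = (j : ℕ) + 1
    · rw [h]
      push_cast
      ring
    · rw [hb, if_neg h]
      simp
  refine ⟨hcomm, ?_⟩
  have hNt : N.transpose = N := by rw [hdiag, Matrix.diagonal_transpose]
  have ht := congrArg Matrix.transpose hcomm
  rw [Matrix.transpose_sub, Matrix.transpose_mul, Matrix.transpose_mul, Matrix.transpose_smul,
    hNt] at ht
  rw [← neg_sub, ht, neg_smul, neg_neg]
end

section
/- Let n ≥ 1, p = 2^n − 1 and p' = 2^(n+1) − 1. Let b' be Green's parafermi matrix of order p' (size 2^(n+1)×2^(n+1)) and let M be the 2^(n+1)×2^(n+1) matrix with M_{2μ, 2μ−1} = 1 for μ = 1,…,2^n and all other entries 0 (i.e., M = I_{2^n} ⊗ b^(1) with b^(1) = [[0,0],[1,0]]). Then the normalized anticommutator (1/2)·(b'·M + M·b') equals b ⊗ I₂, where b is Green's parafermi matrix of order p; explicitly, the entry of (1/2)(b'M + Mb') at position (α,β) equals b_{μ,ν} whenever (α,β) = (2μ−1, 2ν−1) or (α,β) = (2μ, 2ν), and equals 0 otherwise. -/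
/-- The product of two weighted shifts is a weighted shift by two. -/
theorem weighted_shift_mul_apply {R : Type*} [NonUnitalNonAssocSemiring R] {m : ℕ}
    {A B : Matrix (Fin m) (Fin m) R} {f g : ℕ → R}
    (hA : ∀ α β : Fin m, A α β = if (α : ℕ) = β + 1 then f β else 0)
    (hB : ∀ α β : Fin m, B α β = if (α : ℕ) = β + 1 then g β else 0) (α β : Fin m) :
    (A * B) α β = if (α : ℕ) = β + 2 then f (β + 1) * g β else 0 := by
  rw [Matrix.mul_apply]
  split_ifs with h
  · have hlt : (β : ℕ) + 1 < m := by have := α.isLt; omega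
    rw [Finset.sum_eq_single ⟨β + 1, hlt⟩]
    · rw [hA, hB, if_pos h, if_pos rfl]
    · intro γ _ hγ
      rw [hB, if_neg fun h' => hγ (Fin.ext h'), mul_zero]
    · simp
  · refine Finset.sum_eq_zero fun γ _ => ?_
    rw [hA, hB]
    split_ifs with h₁ h₂
    · omega
    all_goals simp

theorem half_mul_sqrt_four_mul (x : ℝ) : 1 / 2 * √(4 * x) = √x := by
  rw [Real.sqrt_mul (by norm_num), show (4 : ℝ) = 2 ^ 2 by norm_num,
    Real.sqrt_sq (by norm_num)]
  ring


/-- Interordinal relation between Green parafermi matrices of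
carry-bit-neighboring orders `p = 2^n − 1` and `p' = 2^(n+1) − 1`:
`(1/2)·(b'·M + M·b') = b ⊗ I₂`, where `M = I_{2^n} ⊗ b⁽¹⁾`.
Indices are 1-based in the informal statement; here `α : Fin (2^(n+1))`
corresponds to the 1-based index `α+1`, so the 1-based positions
`(2μ−1, 2ν−1)` and `(2μ, 2ν)` correspond to `α % 2 = β % 2`, with
`μ−1 = α/2` and `ν−1 = β/2` (0-based). -/
theorem green_interordinal (n : ℕ) (hn : 1 ≤ n)
    (b : Matrix (Fin (2 ^ n)) (Fin (2 ^ n)) ℝ)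
    (hb : ∀ α β : Fin (2 ^ n), b α β =
      if (α : ℕ) = (β : ℕ) + 1 then
        Real.sqrt ((((β : ℕ) : ℝ) + 1) *
          (((2 ^ n - 1 : ℕ) : ℝ) - (((β : ℕ) : ℝ) + 1) + 1))
      else 0)
    (b' : Matrix (Fin (2 ^ (n + 1))) (Fin (2 ^ (n + 1))) ℝ)
    (hb' : ∀ α β : Fin (2 ^ (n + 1)), b' α β =
      if (α : ℕ) = (β : ℕ) + 1 then
        Real.sqrt ((((β : ℕ) : ℝ) + 1) *
          (((2 ^ (n + 1) - 1 : ℕ) : ℝ) - (((β : ℕ) : ℝ) + 1) + 1))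
      else 0)
    (M : Matrix (Fin (2 ^ (n + 1))) (Fin (2 ^ (n + 1))) ℝ)
    (hM : ∀ α β : Fin (2 ^ (n + 1)), M α β =
      if (α : ℕ) = (β : ℕ) + 1 ∧ (β : ℕ) % 2 = 0 then 1 else 0) :
    ∀ α β : Fin (2 ^ (n + 1)),
      ((1 / 2 : ℝ) • (b' * M + M * b')) α β =
        if (α : ℕ) % 2 = (β : ℕ) % 2 then
          b ⟨(α : ℕ) / 2, by have h := α.isLt; have h2 : 2 ^ (n + 1) = 2 ^ n * 2 := pow_succ 2 n; omega⟩
            ⟨(β : ℕ) / 2, by have h := β.isLt; have h2 : 2 ^ (n + 1) = 2 ^ n * 2 := pow_succ 2 n; omega⟩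
        else 0 := by
  intro α β
  let e : ℕ → ℝ := fun k => if k % 2 = 0 then 1 else 0
  have he : ∀ α β : Fin (2 ^ (n + 1)), M α β = if (α : ℕ) = (β : ℕ) + 1 then e β else 0 :=
    fun α β => (hM α β).trans (ite_and ..)
  let w : ℕ → ℝ := fun k =>
    √(((k : ℝ) + 1) * (((2 ^ (n + 1) - 1 : ℕ) : ℝ) - ((k : ℝ) + 1) + 1))
  have hw : ∀ α β : Fin (2 ^ (n + 1)), b' α β = if (α : ℕ) = (β : ℕ) + 1 then w β else 0 := hb'
  rw [Matrix.smul_apply, Matrix.add_apply, weighted_shift_mul_apply (f := w) (g := e) hw he,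
    weighted_shift_mul_apply (f := e) (g := w) he hw, hb, smul_eq_mul]
  by_cases h : (α : ℕ) = β + 2
  · rw [if_pos h, if_pos h, if_pos (by omega), if_pos (by simp only; omega),
      ← half_mul_sqrt_four_mul]
    dsimp only [w, e]
    rw [Nat.cast_sub Nat.one_le_two_pow, Nat.cast_sub Nat.one_le_two_pow]
    rcases Nat.even_or_odd' (β : ℕ) with ⟨k, hk | hk⟩
    · rw [if_pos (by omega), if_neg (by omega), show (β : ℕ) / 2 = k by omega, hk,
        mul_one, zero_mul, add_zero]
      congr 2
      push_cast
      ring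
    · rw [if_neg (by omega), if_pos (by omega), show (β : ℕ) / 2 = k by omega, hk,
        mul_zero, one_mul, zero_add]
      congr 2
      push_cast
      ring
  · rw [if_neg h, if_neg h, add_zero, mul_zero]
    split_ifs with h₁ h₂
    · simp only at h₂
      omega
    · rfl
    · rfl
end
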